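/- Let d ≥ 2 and let g_0 : 𝔻 → ℝ be a bounded measurable function. For every integer p ≥ 1 there exist constants C_p > 0 and ε_0 ∈ (0,1), depending only on d, p and ‖g_0‖_∞, such that for all 0 < ε < ε_0, the p-th moment of the equilibrium fluctuation field is bounded: |E_ε( ζ(g_0)^p )| ≤ C_p, where ζ(g_0) is the function on configurations defined on the n-particle sector by ζ(g_0)(Z_n) := √μ_ε ( μ_ε^{−1} ∑_{i=1}^n g_0(z_i) − E_ε(π(g_0)) ), with π(g_0)(Z_n) := μ_ε^{−1} ∑_{i=1}^n g_0(z_i), and all expectations (which converge absolutely) are taken with respect to the grand canonical hard-sphere Gibbs measure. -/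

import Mathlib

open MeasureTheory Real
open scoped ENNReal BigOperators Classical

noncomputable section

/-- The unit `d`-dimensional torus `𝕋^d = ℝ^d/ℤ^d`, as a product of unit circles.
It carries its Haar probability measure. -/
abbrev Torus (d : ℕ) := Fin d → AddCircle (1 : ℝ)

/-- The Euclidean quotient distance on the torus `𝕋^d`. -/
noncomputable def torusDist {d : ℕ} (x y : Torus d) : ℝ :=
  Real.sqrt (∑ i, dist (x i) (y i) ^ 2)

/-- The one-particle phase space `𝔻 = 𝕋^d × ℝ^d`. -/
abbrev Phase (d : ℕ) := Torus d × EuclideanSpace ℝ (Fin d)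

/-- The standard Maxwellian `M(v) = (2π)^{−d/2} exp(−|v|²/2)`. -/
noncomputable def maxwellian (d : ℕ) (v : EuclideanSpace ℝ (Fin d)) : ℝ :=
  (2 * π) ^ (-(d : ℝ) / 2) * Real.exp (-‖v‖ ^ 2 / 2)

/-- The Boltzmann-Grad density `μ_ε = ε^{−(d−1)}`. -/
noncomputable def mu (d : ℕ) (ε : ℝ) : ℝ := ε ^ (-((d : ℤ) - 1))

/-- The hard-core exclusion: `Z_N ∈ D^ε_N` iff all mutual torus distances of the
positions exceed `ε`. -/
def HardCore (d : ℕ) (ε : ℝ) {N : ℕ} (Z : Fin N → Phase d) : Prop :=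
  ∀ i j, i ≠ j → ε < torusDist (Z i).1 (Z j).1

/-- The density `1_{D^ε_N}(Z_N) M^{⊗N}(V_N)` of the hard-sphere Gibbs weight. -/
noncomputable def hsWeight (d : ℕ) (ε : ℝ) {N : ℕ} (Z : Fin N → Phase d) : ℝ :=
  (if HardCore d ε Z then 1 else 0) * ∏ i, maxwellian d (Z i).2

/-- The grand canonical partition function
`Z^ε = 1 + ∑_{N≥1} (μ_ε^N/N!) ∫ 1_{D^ε_N} M^{⊗N} dZ_N` (the `N = 0` term of the
series equals `1`). -/
noncomputable def partitionFn (d : ℕ) (ε : ℝ) : ℝ :=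
  ∑' N : ℕ, mu d ε ^ N / N.factorial * ∫ Z : Fin N → Phase d, hsWeight d ε Z

/-- The empirical average `π(h)(Z_n) = μ_ε^{−1} ∑_{i=1}^n h(z_i)` on the `n`-particle
sector. -/
noncomputable def empAvg (d : ℕ) (ε : ℝ) (h : Phase d → ℝ) {n : ℕ}
    (Z : Fin n → Phase d) : ℝ :=
  (mu d ε)⁻¹ * ∑ i, h (Z i)

/-- The grand canonical expectation of a family of observables `F_n : 𝔻^n → ℝ`:
`E_ε(F) = (1/Z^ε) ∑_{n≥0} (μ_ε^n/n!) ∫ 1_{D^ε_n} M^{⊗n} F_n dZ_n`. -/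
noncomputable def Eexp (d : ℕ) (ε : ℝ) (F : ∀ n : ℕ, (Fin n → Phase d) → ℝ) : ℝ :=
  (partitionFn d ε)⁻¹ *
    ∑' n : ℕ, mu d ε ^ n / n.factorial * ∫ Z : Fin n → Phase d, hsWeight d ε Z * F n Z

/-- The equilibrium fluctuation field
`ζ(h)(Z_n) = √μ_ε (μ_ε^{−1} ∑_i h(z_i) − E_ε(π(h)))`. -/
noncomputable def fluct (d : ℕ) (ε : ℝ) (h : Phase d → ℝ) (n : ℕ)
    (Z : Fin n → Phase d) : ℝ :=
  Real.sqrt (mu d ε) * (empAvg d ε h Z - Eexp d ε (fun n Z => empAvg d ε h Z))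

/-- Configurations of finitely many labelled points of `X`. -/
abbrev Conf (X : Type*) := Σ n : ℕ, Fin n → X

/-- The inclusion of the `n`-point sector. -/
abbrev sector {X : Type*} (n : ℕ) (Z : Fin n → X) : Conf X := ⟨n, Z⟩

/-- The unnormalised Poisson measure `∑ₙ m^{⊗n} / n!` on configurations. -/
def poissonMeasure {X : Type*} [MeasurableSpace X] (m : Measure X) : Measure (Conf X) :=
  Measure.sum fun n : ℕ =>
    ((n.factorial : ℝ≥0∞)⁻¹) • (Measure.pi fun _ : Fin n => m).map (sector n)

/-- The indicator that all pairs of distinct points are compatible. -/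
def compatInd {X : Type*} (A : X → X → Prop) (ω : Conf X) : ℝ :=
  if ∀ i j, i ≠ j → A (ω.2 i) (ω.2 j) then 1 else 0

/-- The product weight of a configuration. -/
def prodWeight {X : Type*} (φ : X → ℝ) (ω : Conf X) : ℝ := ∏ i, φ (ω.2 i)

/-- The partition function with activity `φ`. -/
def gibbsZ {X : Type*} [MeasurableSpace X] (m : Measure X) (A : X → X → Prop) (φ : X → ℝ) : ℝ :=
  ∫ ω, compatInd A ω * prodWeight φ ω ∂poissonMeasure m

/-- The activity `φ` restricted to points compatible with `y`. -/
def cutOff {X : Type*} (A : X → X → Prop) (y : X) (φ : X → ℝ) (w : X) : ℝ :=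
  if A y w then φ w else 0

section Configurations

variable {X : Type*}

theorem compatInd_nonneg {A : X → X → Prop} (ω : Conf X) : 0 ≤ compatInd A ω := by
  unfold compatInd; split_ifs <;> simp

theorem compatInd_le_one {A : X → X → Prop} (ω : Conf X) : compatInd A ω ≤ 1 := by
  unfold compatInd; split_ifs <;> simp

theorem abs_compatInd_mul_le {A : X → X → Prop} (ω : Conf X) (r : ℝ) :
    |compatInd A ω * r| ≤ |r| := by
  rw [abs_mul, abs_of_nonneg (compatInd_nonneg ω)]
  exact mul_le_of_le_one_left (abs_nonneg r) (compatInd_le_one ω)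

theorem abs_prodWeight_le {φ ψ : X → ℝ} (h : ∀ x, |φ x| ≤ ψ x) (ω : Conf X) :
    |prodWeight φ ω| ≤ prodWeight ψ ω := by
  unfold prodWeight
  rw [Finset.abs_prod]
  exact Finset.prod_le_prod (fun _ _ => abs_nonneg _) fun i _ => h _

theorem abs_cutOff_le {A : X → X → Prop} (y : X) (φ : X → ℝ) (w : X) :
    |cutOff A y φ w| ≤ |φ w| := by
  unfold cutOff; split_ifs <;> simp

theorem abs_sum_mul_prod_erase_le {n : ℕ} (b φ ψ : Fin n → ℝ) (hb : ∀ i, |b i| ≤ ψ i)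
    (hφ : ∀ i, |φ i| ≤ ψ i) :
    |∑ i, b i * ∏ j ∈ Finset.univ.erase i, φ j| ≤ ∏ i, (2 * ψ i) := by
  have key (i : Fin n) : |b i * ∏ j ∈ Finset.univ.erase i, φ j| ≤ ∏ j, ψ j := by
    rw [abs_mul, Finset.abs_prod, ← Finset.mul_prod_erase _ ψ (Finset.mem_univ i)]
    exact mul_le_mul (hb i) (Finset.prod_le_prod (fun _ _ => abs_nonneg _) fun j _ => hφ j)
      (Finset.prod_nonneg fun _ _ => abs_nonneg _) ((abs_nonneg _).trans (hb i))
  have h0 : 0 ≤ ∏ j, ψ j := Finset.prod_nonneg fun j _ => (abs_nonneg _).trans (hb j)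
  calc _ ≤ ∑ i : Fin n, ∏ j, ψ j :=
        (Finset.abs_sum_le_sum_abs _ _).trans (Finset.sum_le_sum fun i _ => key i)
    _ = n * ∏ j, ψ j := by simp
    _ ≤ 2 ^ n * ∏ j, ψ j :=
        mul_le_mul_of_nonneg_right (by exact_mod_cast Nat.lt_two_pow_self.le) h0
    _ = _ := by rw [Finset.prod_mul_distrib]; simp

theorem compatInd_insertNth {A : X → X → Prop} (hs : ∀ x y, A x y → A y x) {n : ℕ}
    (i : Fin (n + 1)) (x : X) (Z : Fin n → X) :
    compatInd A ⟨n + 1, i.insertNth x Z⟩ =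
      compatInd A ⟨n, Z⟩ * ∏ j, (if A x (Z j) then 1 else 0) := by
  have hp : (∏ j, (if A x (Z j) then (1 : ℝ) else 0)) = if ∀ j, A x (Z j) then 1 else 0 := by
    split_ifs with h
    · exact Finset.prod_eq_one fun j _ => by simp [h j]
    · push Not at h
      obtain ⟨j, hj⟩ := h
      exact Finset.prod_eq_zero (Finset.mem_univ j) (by simp [hj])
  have hiff : (∀ k l : Fin (n + 1), k ≠ l →
        A (i.insertNth (α := fun _ => X) x Z k) (i.insertNth (α := fun _ => X) x Z l)) ↔
      (∀ k l, k ≠ l → A (Z k) (Z l)) ∧ ∀ j, A x (Z j) := by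
    constructor
    · intro h
      refine ⟨fun k l hkl => ?_, fun j => ?_⟩
      · simpa using h (i.succAbove k) (i.succAbove l) (by simpa using hkl)
      · simpa using h i (i.succAbove j) (Fin.succAbove_ne i j).symm
    · rintro ⟨h1, h2⟩ k l hkl
      rcases Fin.eq_self_or_eq_succAbove i k with hk | ⟨k, rfl⟩ <;>
        rcases Fin.eq_self_or_eq_succAbove i l with hl | ⟨l, rfl⟩
      · exact absurd (hk.trans hl.symm) hkl
      · simpa [hk] using h2 l
      · simpa [hl] using hs _ _ (h2 k)
      · simpa using h1 k l (fun h => hkl (by rw [h]))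
  rw [hp]
  unfold compatInd
  simp only [hiff]
  by_cases h1 : ∀ k l, k ≠ l → A (Z k) (Z l) <;> by_cases h2 : ∀ j, A x (Z j) <;> simp [h1, h2]

theorem prodWeight_cutOff {A : X → X → Prop} (x : X) (φ : X → ℝ) {n : ℕ} (Z : Fin n → X) :
    prodWeight (cutOff A x φ) ⟨n, Z⟩ = (∏ j, (if A x (Z j) then 1 else 0)) * ∏ j, φ (Z j) := by
  unfold prodWeight cutOff
  rw [← Finset.prod_mul_distrib]
  exact Finset.prod_congr rfl fun j _ => by split_ifs <;> simp

theorem prod_erase_insertNth (φ : X → ℝ) {n : ℕ} (i : Fin (n + 1)) (x : X) (Z : Fin n → X) :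
    ∏ j ∈ Finset.univ.erase i, φ (i.insertNth (α := fun _ => X) x Z j) = ∏ j, φ (Z j) := by
  have : Finset.univ.erase i = Finset.univ.map (Fin.succAboveEmb i) := by
    ext j
    rcases Fin.eq_self_or_eq_succAbove i j with rfl | ⟨k, rfl⟩ <;>
      simp [Fin.succAbove_ne]
  rw [this, Finset.prod_map]
  simp

variable [MeasurableSpace X]

omit [MeasurableSpace X] in
theorem sector_injective (n : ℕ) : Function.Injective (sector (X := X) n) := by
  intro Z W h
  simpa [sector] using h

theorem measurable_sector (n : ℕ) : Measurable (sector (X := X) n) :=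
  Measurable.of_le_map (iInf_le _ n)

theorem measurableEmbedding_sector (n : ℕ) :
    MeasurableEmbedding (sector (X := X) n) where
  injective := sector_injective n
  measurable := measurable_sector n
  measurableSet_image' := by
    intro s hs
    refine MeasurableSpace.measurableSet_iInf.2 fun k => ?_
    change MeasurableSet (sector k ⁻¹' (sector n '' s))
    by_cases h : k = n
    · subst h
      rwa [Set.preimage_image_eq _ (sector_injective _)]
    · convert MeasurableSet.empty
      ext z
      simp only [Set.mem_preimage, Set.mem_image, Set.mem_empty_iff_false, iff_false, not_exists,
        not_and]
      intro w _ hw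
      exact h (congrArg Sigma.fst hw).symm

theorem measurable_conf {f : Conf X → ℝ}
    (h : ∀ n : ℕ, Measurable fun Z : Fin n → X => f ⟨n, Z⟩) : Measurable f := by
  intro s hs
  exact MeasurableSpace.measurableSet_iInf.2 fun k => h k hs

theorem measurable_prod_conf {f : X × Conf X → ℝ}
    (h : ∀ n : ℕ, Measurable fun p : X × (Fin n → X) => f (p.1, ⟨n, p.2⟩)) : Measurable f := by
  intro s hs
  have : f ⁻¹' s = ⋃ n : ℕ, Prod.map id (sector n) ''
      ((fun p : X × (Fin n → X) => f (p.1, ⟨n, p.2⟩)) ⁻¹' s) := by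
    ext ⟨x, n, Z⟩
    simp only [Set.mem_preimage, Set.mem_iUnion, Set.mem_image, Prod.exists, Prod.map_apply, id_eq]
    constructor
    · intro hx
      exact ⟨n, x, Z, hx, rfl⟩
    · rintro ⟨k, y, W, hy, he⟩
      rw [← he]
      exact hy
  rw [this]
  exact MeasurableSet.iUnion fun n =>
    ((MeasurableEmbedding.id).prodMap (measurableEmbedding_sector n)).measurableSet_image' (h n hs)

variable {m : Measure X}

theorem integral_sector (n : ℕ) (f : Conf X → ℝ) :
    ∫ ω, f ω ∂(((n.factorial : ℝ≥0∞)⁻¹) • (Measure.pi fun _ : Fin n => m).map (sector n)) =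
      (n.factorial : ℝ)⁻¹ * ∫ Z, f ⟨n, Z⟩ ∂(Measure.pi fun _ : Fin n => m) := by
  rw [integral_smul_measure, (measurableEmbedding_sector n).integral_map]
  simp

theorem integrable_sector {n : ℕ} {f : Conf X → ℝ} :
    Integrable f
      (((n.factorial : ℝ≥0∞)⁻¹) • (Measure.pi fun _ : Fin n => m).map (sector n)) ↔
      Integrable (fun Z => f ⟨n, Z⟩) (Measure.pi fun _ : Fin n => m) := by
  rw [integrable_smul_measure (by simp) (by simp [Nat.factorial_ne_zero]),
    (measurableEmbedding_sector n).integrable_map_iff]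
  rfl

variable [SigmaFinite m]

instance : SFinite (poissonMeasure m) := by
  unfold poissonMeasure
  infer_instance

omit [SigmaFinite m] in
theorem hasSum_poisson {f : Conf X → ℝ} (hf : Integrable f (poissonMeasure m)) :
    HasSum (fun n : ℕ => (n.factorial : ℝ)⁻¹ * ∫ Z, f ⟨n, Z⟩ ∂(Measure.pi fun _ : Fin n => m))
      (∫ ω, f ω ∂poissonMeasure m) := by
  have := hasSum_integral_measure hf
  unfold poissonMeasure
  simpa only [integral_sector] using this

theorem integrable_conf_of_le_prod {f : Conf X → ℝ} {φ : X → ℝ} (hf : Measurable f)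
    (hφ : Integrable φ m) (h : ∀ ω, |f ω| ≤ prodWeight φ ω) :
    Integrable f (poissonMeasure m) := by
  have hn (n : ℕ) : Integrable (fun Z => f ⟨n, Z⟩) (Measure.pi fun _ : Fin n => m) :=
    (Integrable.fintype_prod (f := fun _ => φ) (fun _ : Fin n => hφ)).mono'
      (hf.comp (measurable_sector n)).aestronglyMeasurable (ae_of_all _ fun Z => h ⟨n, Z⟩)
  refine integrable_sum_measure (fun n => integrable_sector.2 (hn n)) ?_
  simp only [integral_sector]
  refine Summable.of_nonneg_of_le (fun n => by positivity) (fun n => ?_)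
    (Real.summable_pow_div_factorial (∫ x, φ x ∂m))
  rw [div_eq_inv_mul]
  refine mul_le_mul_of_nonneg_left ?_ (by positivity)
  calc _ ≤ ∫ Z : Fin n → X, ∏ i, φ (Z i) ∂(Measure.pi fun _ : Fin n => m) :=
        integral_mono (hn n).norm
          (Integrable.fintype_prod (f := fun _ => φ) (fun _ : Fin n => hφ)) fun Z => h ⟨n, Z⟩
    _ = _ := by
        rw [integral_fintype_prod_eq_pow]
        simp

theorem measurable_prodWeight {φ : X → ℝ} (hφ : Measurable φ) : Measurable (prodWeight φ) :=
  measurable_conf fun n => by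
    unfold prodWeight
    refine Finset.measurable_prod Finset.univ (f := fun i (Z : Fin n → X) => φ (Z i)) fun i _ => ?_
    exact hφ.comp (measurable_pi_apply i)

theorem measurable_compatInd {A : X → X → Prop} (hA : MeasurableSet {p : X × X | A p.1 p.2}) :
    Measurable (compatInd A) := by
  refine measurable_conf fun n => ?_
  unfold compatInd
  refine Measurable.ite ?_ measurable_const measurable_const
  simp only [Set.ofPred_forall]
  refine MeasurableSet.iInter fun i => MeasurableSet.iInter fun j => MeasurableSet.iInter fun _ => ?_
  exact ((measurable_pi_apply (X := fun _ => X) i).prodMk (measurable_pi_apply j)) hA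

theorem integrable_gibbs {A : X → X → Prop} (hA : MeasurableSet {p : X × X | A p.1 p.2})
    {φ : X → ℝ} (hm : Measurable φ) (hφ : Integrable φ m) :
    Integrable (fun ω => compatInd A ω * prodWeight φ ω) (poissonMeasure m) :=
  integrable_conf_of_le_prod ((measurable_compatInd hA).mul (measurable_prodWeight hm)) hφ.abs
    fun ω => (abs_compatInd_mul_le ω _).trans (abs_prodWeight_le (fun _ => le_rfl) ω)

theorem measurable_cutOff {A : X → X → Prop} (hA : MeasurableSet {p : X × X | A p.1 p.2})
    {φ : X → ℝ} (hm : Measurable φ) : Measurable fun p : X × X => cutOff A p.1 φ p.2 :=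
  Measurable.ite hA (hm.comp measurable_snd) measurable_const

/-- The derivative of the product weight: one point carries `b`, the others carry `φ`. -/
def markedWeight (b φ : X → ℝ) (ω : Conf X) : ℝ :=
  ∑ i, b (ω.2 i) * ∏ j ∈ Finset.univ.erase i, φ (ω.2 j)

theorem measurable_markedWeight {b φ : X → ℝ} (hb : Measurable b) (hφ : Measurable φ) :
    Measurable (markedWeight b φ) := by
  refine measurable_conf fun n => ?_
  unfold markedWeight
  refine Finset.measurable_sum Finset.univ
    (f := fun i (Z : Fin n → X) => b (Z i) * ∏ j ∈ Finset.univ.erase i, φ (Z j)) fun i _ => ?_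
  refine (hb.comp (measurable_pi_apply i)).mul ?_
  refine Finset.measurable_prod (Finset.univ.erase i)
    (f := fun j (Z : Fin n → X) => φ (Z j)) fun j _ => ?_
  exact hφ.comp (measurable_pi_apply j)

theorem integrable_marked {A : X → X → Prop} (hA : MeasurableSet {p : X × X | A p.1 p.2})
    {b φ : X → ℝ} (hbm : Measurable b) (hφm : Measurable φ) (hb : Integrable b m)
    (hφ : Integrable φ m) :
    Integrable (fun ω => compatInd A ω * markedWeight b φ ω) (poissonMeasure m) := by
  refine integrable_conf_of_le_prod (φ := fun x => 2 * (|b x| + |φ x|))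
    ((measurable_compatInd hA).mul (measurable_markedWeight hbm hφm))
    ((hb.abs.add hφ.abs).const_mul 2) fun ω => (abs_compatInd_mul_le ω _).trans ?_
  exact abs_sum_mul_prod_erase_le (fun i => b (ω.2 i)) (fun i => φ (ω.2 i))
    (fun i => |b (ω.2 i)| + |φ (ω.2 i)|) (fun i => by simp) (fun i => by simp)

theorem measurable_insert_weight {A : X → X → Prop}
    (hA : MeasurableSet {p : X × X | A p.1 p.2}) {b φ : X → ℝ} (hbm : Measurable b)
    (hφm : Measurable φ) :
    Measurable fun p : X × Conf X =>
      b p.1 * (compatInd A p.2 * prodWeight (cutOff A p.1 φ) p.2) := by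
  refine measurable_prod_conf fun n => ?_
  refine (hbm.comp measurable_fst).mul (Measurable.mul ?_ ?_)
  · exact (measurable_compatInd hA).comp ((measurable_sector n).comp measurable_snd)
  · unfold prodWeight
    refine Finset.measurable_prod Finset.univ
      (f := fun j (p : X × (Fin n → X)) => cutOff A p.1 φ (p.2 j)) fun j _ => ?_
    exact (measurable_cutOff hA hφm).comp
      (measurable_fst.prodMk ((measurable_pi_apply j).comp measurable_snd))

omit [MeasurableSpace X] in
theorem abs_insert_weight_le {A : X → X → Prop} (b φ : X → ℝ) (x : X) (ω : Conf X) :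
    |b x * (compatInd A ω * prodWeight (cutOff A x φ) ω)| ≤
      |b x| * prodWeight (fun y => |φ y|) ω := by
  rw [abs_mul]
  refine mul_le_mul_of_nonneg_left ?_ (abs_nonneg _)
  exact (abs_compatInd_mul_le ω _).trans (abs_prodWeight_le (fun w => abs_cutOff_le x φ w) ω)

theorem integrable_insert_weight {A : X → X → Prop}
    (hA : MeasurableSet {p : X × X | A p.1 p.2}) {b φ : X → ℝ} (hbm : Measurable b)
    (hφm : Measurable φ) (hb : Integrable b m) (hφ : Integrable φ m) :
    Integrable (fun p : X × Conf X =>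
      b p.1 * (compatInd A p.2 * prodWeight (cutOff A p.1 φ) p.2))
      (m.prod (poissonMeasure m)) := by
  have hW : Integrable (prodWeight fun y => |φ y|) (poissonMeasure m) := by
    refine integrable_conf_of_le_prod (measurable_prodWeight hφm.norm) hφ.abs fun ω => ?_
    exact abs_prodWeight_le (fun x => by simp) ω
  refine (hb.abs.mul_prod hW).mono' (measurable_insert_weight hA hbm hφm).aestronglyMeasurable ?_
  exact ae_of_all _ fun p => abs_insert_weight_le b φ p.1 p.2

theorem integral_marked_sector {A : X → X → Prop}
    (hA : MeasurableSet {p : X × X | A p.1 p.2}) (hs : ∀ x y, A x y → A y x) {b φ : X → ℝ}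
    (hbm : Measurable b) (hφm : Measurable φ) (hb : Integrable b m) (hφ : Integrable φ m) (n : ℕ) :
    ∫ Z, compatInd A ⟨n + 1, Z⟩ * markedWeight b φ ⟨n + 1, Z⟩ ∂(Measure.pi fun _ => m) =
      (n + 1) * ∫ Z, ∫ x, b x * (compatInd A ⟨n, Z⟩ * prodWeight (cutOff A x φ) ⟨n, Z⟩) ∂m
        ∂(Measure.pi fun _ : Fin n => m) := by
  set G : X × (Fin n → X) → ℝ := fun p =>
    b p.1 * (compatInd A ⟨n, p.2⟩ * prodWeight (cutOff A p.1 φ) ⟨n, p.2⟩) with hG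
  have hGm : Measurable G :=
    (measurable_insert_weight hA hbm hφm).comp
      (measurable_fst.prodMk ((measurable_sector n).comp measurable_snd))
  have hGi : Integrable G (m.prod (Measure.pi fun _ : Fin n => m)) := by
    refine (hb.abs.mul_prod (Integrable.fintype_prod (f := fun _ y => |φ y|)
      (fun _ : Fin n => hφ.abs))).mono' hGm.aestronglyMeasurable ?_
    exact ae_of_all _ fun p => abs_insert_weight_le b φ p.1 ⟨n, p.2⟩
  have hterm (i : Fin (n + 1)) :
      (fun Z : Fin (n + 1) → X => compatInd A ⟨n + 1, Z⟩ *
        (b (Z i) * ∏ j ∈ Finset.univ.erase i, φ (Z j))) =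
      fun Z => G (MeasurableEquiv.piFinSuccAbove (fun _ => X) i Z) := by
    funext Z
    obtain ⟨⟨x, W⟩, rfl⟩ := (MeasurableEquiv.piFinSuccAbove (fun _ => X) i).symm.surjective Z
    have hZ : (MeasurableEquiv.piFinSuccAbove (fun _ => X) i).symm (x, W) =
      i.insertNth (α := fun _ => X) x W := rfl
    rw [MeasurableEquiv.apply_symm_apply, hZ, compatInd_insertNth hs, prod_erase_insertNth]
    simp only [hG, Fin.insertNth_apply_same, prodWeight_cutOff]
    ring
  have hmp (i : Fin (n + 1)) := measurePreserving_piFinSuccAbove (fun _ : Fin (n + 1) => m) i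
  have hint (i : Fin (n + 1)) : Integrable (fun Z : Fin (n + 1) → X => compatInd A ⟨n + 1, Z⟩ *
        (b (Z i) * ∏ j ∈ Finset.univ.erase i, φ (Z j))) (Measure.pi fun _ => m) := by
    rw [hterm]
    exact (hmp i).integrable_comp_of_integrable hGi
  have hval (i : Fin (n + 1)) : ∫ Z, compatInd A ⟨n + 1, Z⟩ *
        (b (Z i) * ∏ j ∈ Finset.univ.erase i, φ (Z j)) ∂(Measure.pi fun _ => m) =
      ∫ Z, ∫ x, G (x, Z) ∂m ∂(Measure.pi fun _ : Fin n => m) := by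
    rw [hterm, (hmp i).integral_comp', integral_prod_symm _ hGi]
  have hsum (Z : Fin (n + 1) → X) : compatInd A ⟨n + 1, Z⟩ * markedWeight b φ ⟨n + 1, Z⟩ =
      ∑ i : Fin (n + 1), compatInd A ⟨n + 1, Z⟩ *
        (b (Z i) * ∏ j ∈ Finset.univ.erase i, φ (Z j)) := Finset.mul_sum _ _ _
  simp only [hsum]
  rw [integral_finsetSum _ fun i _ => hint i]
  simp only [hval]
  simp [hG]

/-- The Mecke formula for the hard-core gas. -/
theorem integral_marked {A : X → X → Prop}
    (hA : MeasurableSet {p : X × X | A p.1 p.2}) (hs : ∀ x y, A x y → A y x) {b φ : X → ℝ}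
    (hbm : Measurable b) (hφm : Measurable φ) (hb : Integrable b m) (hφ : Integrable φ m) :
    ∫ ω, compatInd A ω * markedWeight b φ ω ∂poissonMeasure m =
      ∫ x, b x * gibbsZ m A (cutOff A x φ) ∂m := by
  have hG := integrable_insert_weight (m := m) hA hbm hφm hb hφ
  have h1 := hasSum_poisson (integrable_marked (m := m) hA hbm hφm hb hφ)
  have h2 := hasSum_poisson hG.integral_prod_right
  rw [← integral_prod_symm _ hG, integral_prod _ hG] at h2
  have h3 := (hasSum_nat_add_iff' 1).2 h1
  have h0 : ∀ Z : Fin 0 → X, markedWeight b φ ⟨0, Z⟩ = 0 := fun Z => by simp [markedWeight]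
  simp only [Finset.range_one, Finset.sum_singleton, h0, mul_zero, integral_zero, sub_zero] at h3
  have he (n : ℕ) : ((n + 1).factorial : ℝ)⁻¹ *
        ∫ Z, compatInd A ⟨n + 1, Z⟩ * markedWeight b φ ⟨n + 1, Z⟩ ∂(Measure.pi fun _ => m) =
      (n.factorial : ℝ)⁻¹ * ∫ Z, ∫ x, b x * (compatInd A ⟨n, Z⟩ *
        prodWeight (cutOff A x φ) ⟨n, Z⟩) ∂m ∂(Measure.pi fun _ : Fin n => m) := by
    rw [integral_marked_sector hA hs hbm hφm hb hφ, ← mul_assoc]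
    congr 1
    rw [Nat.factorial_succ]
    have : (n.factorial : ℝ) ≠ 0 := by positivity
    push_cast
    field_simp
  simp only [he] at h3
  simpa only [integral_const_mul, gibbsZ] using h3.unique h2

theorem integrable_mul_gibbsZ_cutOff {A : X → X → Prop}
    (hA : MeasurableSet {p : X × X | A p.1 p.2}) {b φ : X → ℝ}
    (hbm : Measurable b) (hφm : Measurable φ) (hb : Integrable b m) (hφ : Integrable φ m) :
    Integrable (fun x => b x * gibbsZ m A (cutOff A x φ)) m := by
  have := (integrable_insert_weight (m := m) hA hbm hφm hb hφ).integral_prod_left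
  simpa only [integral_const_mul, gibbsZ] using this

theorem one_le_gibbsZ {A : X → X → Prop} (hA : MeasurableSet {p : X × X | A p.1 p.2})
    {φ : X → ℝ} (hm : Measurable φ) (hφ : Integrable φ m) (h0 : ∀ x, 0 ≤ φ x) :
    1 ≤ gibbsZ m A φ := by
  have h := hasSum_poisson (integrable_gibbs (m := m) hA hm hφ)
  have := le_hasSum h 0 fun n _ => mul_nonneg (by positivity) <| integral_nonneg fun Z =>
    mul_nonneg (compatInd_nonneg _) (Finset.prod_nonneg fun i _ => h0 _)
  have hu : (Measure.pi fun _ : Fin 0 => m).real Set.univ = 1 := by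
    rw [Measure.pi_of_empty]
    simp
  have h1 (Z : Fin 0 → X) : compatInd A ⟨0, Z⟩ * prodWeight φ ⟨0, Z⟩ = 1 := by
    simp [compatInd, prodWeight]
  simpa [h1, hu, gibbsZ] using this

theorem gibbsZ_mono {A : X → X → Prop} (hA : MeasurableSet {p : X × X | A p.1 p.2})
    {φ ψ : X → ℝ} (hφm : Measurable φ) (hφ : Integrable φ m) (hψm : Measurable ψ)
    (hψ : Integrable ψ m) (h0 : ∀ x, 0 ≤ φ x) (h : ∀ x, φ x ≤ ψ x) :
    gibbsZ m A φ ≤ gibbsZ m A ψ := by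
  refine integral_mono (integrable_gibbs hA hφm hφ) (integrable_gibbs hA hψm hψ) fun ω => ?_
  exact mul_le_mul_of_nonneg_left (Finset.prod_le_prod (fun _ _ => h0 _) fun _ _ => h _)
    (compatInd_nonneg ω)

theorem hasDerivAt_gibbsZ {A : X → X → Prop} (hA : MeasurableSet {p : X × X | A p.1 p.2})
    (hs : ∀ x y, A x y → A y x) {b φ : X → ℝ} (hbm : Measurable b) (hφm : Measurable φ)
    (hb : Integrable b m) (hφ : Integrable φ m) (u₀ : ℝ) :
    HasDerivAt (fun u => gibbsZ m A fun x => φ x + u * b x)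
      (∫ x, b x * gibbsZ m A (cutOff A x fun w => φ w + u₀ * b w) ∂m) u₀ := by
  have hum (u : ℝ) : Measurable fun x => φ x + u * b x := hφm.add (hbm.const_mul u)
  have hui (u : ℝ) : Integrable (fun x => φ x + u * b x) m := hφ.add (hb.const_mul u)
  rw [← integral_marked hA hs hbm (hum u₀) hb (hui u₀)]
  refine (hasDerivAt_integral_of_dominated_loc_of_deriv_le
    (F := fun u ω => compatInd A ω * prodWeight (fun x => φ x + u * b x) ω)
    (F' := fun u ω => compatInd A ω * markedWeight b (fun x => φ x + u * b x) ω)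
    (bound := prodWeight fun x => 2 * (|φ x| + (|u₀| + 1) * |b x|))
    (Metric.ball_mem_nhds u₀ one_pos)
    (Filter.Eventually.of_forall fun u =>
      ((measurable_compatInd hA).mul (measurable_prodWeight (hum u))).aestronglyMeasurable)
    (integrable_gibbs hA (hum u₀) (hui u₀))
    ((measurable_compatInd hA).mul (measurable_markedWeight hbm (hum u₀))).aestronglyMeasurable
    (ae_of_all _ fun ω u hu => ?_) ?_ (ae_of_all _ fun ω u _ => ?_)).2
  · rw [Metric.mem_ball, Real.dist_eq] at hu
    have hu' : |u| ≤ |u₀| + 1 := by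
      have := abs_add_le (u - u₀) u₀
      rw [sub_add_cancel] at this
      linarith
    refine (abs_compatInd_mul_le ω _).trans ?_
    refine abs_sum_mul_prod_erase_le (fun i => b (ω.2 i)) (fun i => φ (ω.2 i) + u * b (ω.2 i))
      (fun i => |φ (ω.2 i)| + (|u₀| + 1) * |b (ω.2 i)|) (fun i => ?_) fun i => ?_
    · nlinarith [abs_nonneg (φ (ω.2 i)), mul_nonneg (abs_nonneg u₀) (abs_nonneg (b (ω.2 i)))]
    · refine (abs_add_le _ _).trans ?_
      rw [abs_mul]
      gcongr
  · refine integrable_conf_of_le_prod (φ := fun x => 2 * (|φ x| + (|u₀| + 1) * |b x|))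
      (measurable_prodWeight ((hφm.norm.add (hbm.norm.const_mul _)).const_mul 2))
      ((hφ.abs.add (hb.abs.const_mul _)).const_mul 2) fun ω => ?_
    refine abs_prodWeight_le (fun x => ?_) ω
    rw [abs_of_nonneg (by positivity)]
  · refine HasDerivAt.const_mul _ ?_
    have := HasDerivAt.fun_finsetProd (u := Finset.univ)
      (f := fun (i : Fin ω.1) u => φ (ω.2 i) + u * b (ω.2 i)) (f' := fun i => b (ω.2 i)) (x := u)
      fun i _ => by simpa using ((hasDerivAt_id u).mul_const (b (ω.2 i))).const_add (φ (ω.2 i))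
    simpa only [prodWeight, markedWeight, smul_eq_mul, mul_comm (b _)] using this

/-- The free energy cost of making room for a particle at `y`. -/
def insertionCost (m : Measure X) (A : X → X → Prop) (φ : X → ℝ) (y : X) : ℝ :=
  Real.log (gibbsZ m A φ) - Real.log (gibbsZ m A (cutOff A y φ))

/-- Two activities dominated by `Φ` and comparable up to the factor `exp δ`. -/
structure ActivityPair (Φ : X → ℝ) (δ : ℝ) (φ ψ : X → ℝ) : Prop where
  meas_left : Measurable φ
  meas_right : Measurable ψ
  nonneg_left : ∀ x, 0 ≤ φ x
  nonneg_right : ∀ x, 0 ≤ ψ x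
  le_left : ∀ x, φ x ≤ Φ x
  le_right : ∀ x, ψ x ≤ Φ x
  left_le : ∀ x, φ x ≤ Real.exp δ * ψ x
  right_le : ∀ x, ψ x ≤ Real.exp δ * φ x

omit [SigmaFinite m] in
theorem ActivityPair.integrable_left {Φ φ ψ : X → ℝ} {δ : ℝ} (h : ActivityPair Φ δ φ ψ)
    (hΦ : Integrable Φ m) : Integrable φ m :=
  hΦ.mono' h.meas_left.aestronglyMeasurable
    (ae_of_all _ fun x => by rw [Real.norm_of_nonneg (h.nonneg_left x)]; exact h.le_left x)

omit [SigmaFinite m] in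
theorem ActivityPair.integrable_right {Φ φ ψ : X → ℝ} {δ : ℝ} (h : ActivityPair Φ δ φ ψ)
    (hΦ : Integrable Φ m) : Integrable ψ m :=
  hΦ.mono' h.meas_right.aestronglyMeasurable
    (ae_of_all _ fun x => by rw [Real.norm_of_nonneg (h.nonneg_right x)]; exact h.le_right x)

theorem ActivityPair.mul {Φ φ ψ k : X → ℝ} {δ : ℝ} (h : ActivityPair Φ δ φ ψ)
    (hk : Measurable k) (h0 : ∀ x, 0 ≤ k x) (h1 : ∀ x, k x ≤ 1) :
    ActivityPair Φ δ (fun x => k x * φ x) (fun x => k x * ψ x) where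
  meas_left := hk.mul h.meas_left
  meas_right := hk.mul h.meas_right
  nonneg_left x := mul_nonneg (h0 x) (h.nonneg_left x)
  nonneg_right x := mul_nonneg (h0 x) (h.nonneg_right x)
  le_left x := (mul_le_of_le_one_left (h.nonneg_left x) (h1 x)).trans (h.le_left x)
  le_right x := (mul_le_of_le_one_left (h.nonneg_right x) (h1 x)).trans (h.le_right x)
  left_le x := by
    have := mul_le_mul_of_nonneg_left (h.left_le x) (h0 x)
    linarith
  right_le x := by
    have := mul_le_mul_of_nonneg_left (h.right_le x) (h0 x)
    linarith

theorem measurable_cutOff_right {A : X → X → Prop} (hA : MeasurableSet {p : X × X | A p.1 p.2})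
    {φ : X → ℝ} (hm : Measurable φ) (y : X) : Measurable (cutOff A y φ) :=
  (measurable_cutOff hA hm).comp (measurable_const.prodMk measurable_id)

omit [SigmaFinite m] in
theorem integrable_cutOff {A : X → X → Prop} (hA : MeasurableSet {p : X × X | A p.1 p.2})
    {φ : X → ℝ} (hm : Measurable φ) (hφ : Integrable φ m) (y : X) :
    Integrable (cutOff A y φ) m :=
  hφ.abs.mono' (measurable_cutOff_right hA hm y).aestronglyMeasurable
    (ae_of_all _ fun w => abs_cutOff_le y φ w)

omit [MeasurableSpace X] in
theorem cutOff_nonneg {A : X → X → Prop} {φ : X → ℝ} (h0 : ∀ x, 0 ≤ φ x) (y w : X) :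
    0 ≤ cutOff A y φ w := by
  unfold cutOff; split_ifs <;> simp [h0]

omit [MeasurableSpace X] in
theorem cutOff_le {A : X → X → Prop} {φ : X → ℝ} (h0 : ∀ x, 0 ≤ φ x) (y w : X) :
    cutOff A y φ w ≤ φ w := by
  unfold cutOff; split_ifs <;> simp [h0]

theorem insertionCost_nonneg {A : X → X → Prop} (hA : MeasurableSet {p : X × X | A p.1 p.2})
    {φ : X → ℝ} (hm : Measurable φ) (hφ : Integrable φ m) (h0 : ∀ x, 0 ≤ φ x) (y : X) :
    0 ≤ insertionCost m A φ y := by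
  have h1 := one_le_gibbsZ (m := m) hA (measurable_cutOff_right hA hm y)
    (integrable_cutOff hA hm hφ y) (cutOff_nonneg h0 y)
  have h2 := gibbsZ_mono (m := m) hA (measurable_cutOff_right hA hm y)
    (integrable_cutOff hA hm hφ y) hm hφ (cutOff_nonneg h0 y) (cutOff_le h0 y)
  exact sub_nonneg.2 (Real.log_le_log (by linarith) h2)

theorem insertionCost_le {A : X → X → Prop} (hA : MeasurableSet {p : X × X | A p.1 p.2})
    {φ Φ : X → ℝ} (hm : Measurable φ) (hφ : Integrable φ m) (h0 : ∀ x, 0 ≤ φ x)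
    (hΦm : Measurable Φ) (hΦ : Integrable Φ m) (h : ∀ x, φ x ≤ Φ x) (y : X) :
    insertionCost m A φ y ≤ Real.log (gibbsZ m A Φ) := by
  have h1 := one_le_gibbsZ (m := m) hA (measurable_cutOff_right hA hm y)
    (integrable_cutOff hA hm hφ y) (cutOff_nonneg h0 y)
  have h2 := one_le_gibbsZ (m := m) hA hm hφ h0
  have h3 := Real.log_le_log (by linarith) (gibbsZ_mono (m := m) hA hm hφ hΦm hΦ h0 h)
  have h4 := Real.log_nonneg h1
  unfold insertionCost
  linarith

theorem gibbsZ_cutOff_div {A : X → X → Prop} (hA : MeasurableSet {p : X × X | A p.1 p.2})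
    {φ : X → ℝ} (hm : Measurable φ) (hφ : Integrable φ m) (h0 : ∀ x, 0 ≤ φ x) (y : X) :
    gibbsZ m A (cutOff A y φ) / gibbsZ m A φ = Real.exp (-insertionCost m A φ y) := by
  have h1 := one_le_gibbsZ (m := m) hA (measurable_cutOff_right hA hm y)
    (integrable_cutOff hA hm hφ y) (cutOff_nonneg h0 y)
  have h2 := one_le_gibbsZ (m := m) hA hm hφ h0
  rw [insertionCost, neg_sub, Real.exp_sub, Real.exp_log (by linarith), Real.exp_log (by linarith)]

theorem abs_sub_le_mul_of_le_exp {p q P s : ℝ} (hs : 0 ≤ s) (hp : 0 ≤ p) (hq : 0 ≤ q)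
    (hpP : p ≤ P) (hqP : q ≤ P) (h1 : p ≤ Real.exp s * q) (h2 : q ≤ Real.exp s * p) :
    |p - q| ≤ P * s := by
  have key : ∀ a c : ℝ, 0 ≤ a → a ≤ P → a ≤ Real.exp s * c → a - c ≤ P * s := by
    intro a c ha haP hac
    have h3 : Real.exp (-s) * a ≤ c := by
      rw [Real.exp_neg, inv_mul_le_iff₀ (Real.exp_pos s)]
      exact hac
    have h4 := Real.add_one_le_exp (-s)
    nlinarith [mul_le_mul_of_nonneg_right haP hs]
  exact abs_sub_le_iff.2 ⟨key p q hp hpP h1, key q p hq hqP h2⟩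

theorem ActivityPair.abs_density_sub_le {A : X → X → Prop}
    (hA : MeasurableSet {p : X × X | A p.1 p.2}) {Φ φ ψ : X → ℝ} {δ D : ℝ}
    (hΦ : Integrable Φ m) (h : ActivityPair Φ δ φ ψ) (hδ : 0 ≤ δ) {x : X}
    (hD : |insertionCost m A φ x - insertionCost m A ψ x| ≤ D) {r s : ℝ}
    (hr0 : 0 ≤ r) (hs0 : 0 ≤ s) (hr : r ≤ Φ x) (hs : s ≤ Φ x) (hrs : r ≤ Real.exp δ * s)
    (hsr : s ≤ Real.exp δ * r) :
    |r * Real.exp (-insertionCost m A φ x) - s * Real.exp (-insertionCost m A ψ x)| ≤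
      Φ x * (δ + D) := by
  have h1 := insertionCost_nonneg (m := m) hA h.meas_left (h.integrable_left hΦ) h.nonneg_left x
  have h2 := insertionCost_nonneg (m := m) hA h.meas_right (h.integrable_right hΦ) h.nonneg_right x
  have hD0 : 0 ≤ D := (abs_nonneg _).trans hD
  obtain ⟨hD1, hD2⟩ := abs_le.1 hD
  set a := insertionCost m A φ x
  set c := insertionCost m A ψ x
  refine abs_sub_le_mul_of_le_exp (by positivity) (by positivity) (by positivity) ?_ ?_ ?_ ?_
  · exact (mul_le_of_le_one_right hr0 (Real.exp_le_one_iff.2 (by linarith))).trans hr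
  · exact (mul_le_of_le_one_right hs0 (Real.exp_le_one_iff.2 (by linarith))).trans hs
  · calc r * Real.exp (-a) ≤ (Real.exp δ * s) * Real.exp (D - c) :=
          mul_le_mul hrs (Real.exp_le_exp.2 (by linarith)) (Real.exp_pos _).le (by positivity)
      _ = _ := by rw [Real.exp_add, Real.exp_sub, Real.exp_neg]; ring
  · calc s * Real.exp (-c) ≤ (Real.exp δ * r) * Real.exp (D - a) :=
          mul_le_mul hsr (Real.exp_le_exp.2 (by linarith)) (Real.exp_pos _).le (by positivity)
      _ = _ := by rw [Real.exp_add, Real.exp_sub, Real.exp_neg]; ring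

/-- The activity `φ` with the points incompatible with `y` weighted by `u`. -/
def dimmed (A : X → X → Prop) (y : X) (u : ℝ) (φ : X → ℝ) (x : X) : ℝ :=
  (if A y x then 1 else u) * φ x

theorem hasDerivAt_log_gibbsZ_dimmed {A : X → X → Prop}
    (hA : MeasurableSet {p : X × X | A p.1 p.2}) (hs : ∀ x y, A x y → A y x) {φ : X → ℝ}
    (hφm : Measurable φ) (hφ : Integrable φ m) (h0 : ∀ x, 0 ≤ φ x) (y : X) {u : ℝ} (hu : 0 ≤ u)
    (hdm : Measurable (dimmed A y u φ)) (hdi : Integrable (dimmed A y u φ) m) :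
    Integrable (fun x => (φ x - cutOff A y φ x) *
        Real.exp (-insertionCost m A (dimmed A y u φ) x)) m ∧
    HasDerivAt (fun v => Real.log (gibbsZ m A (dimmed A y v φ)))
      (∫ x, (φ x - cutOff A y φ x) * Real.exp (-insertionCost m A (dimmed A y u φ) x) ∂m) u := by
  have hcm := measurable_cutOff_right hA hφm y
  have hci := integrable_cutOff hA hφm hφ y
  have hd (v : ℝ) : (fun x => cutOff A y φ x + v * (φ x - cutOff A y φ x)) = dimmed A y v φ := by
    funext x
    unfold cutOff dimmed
    split_ifs <;> ring
  have hd0 : ∀ x, 0 ≤ dimmed A y u φ x := fun x =>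
    mul_nonneg (by split_ifs <;> simp [hu]) (h0 x)
  have h1 := one_le_gibbsZ (m := m) hA hdm hdi hd0
  have hder := hasDerivAt_gibbsZ (m := m) hA hs (hφm.sub hcm) hcm (hφ.sub hci) hci u
  have hint := integrable_mul_gibbsZ_cutOff (m := m) hA (hφm.sub hcm) hdm (hφ.sub hci) hdi
  simp only [Pi.sub_apply, hd] at hder hint
  have hlog := hder.log (by linarith)
  rw [← integral_div] at hlog
  have hint' := hint.div_const (gibbsZ m A (dimmed A y u φ))
  simp only [mul_div_assoc, gibbsZ_cutOff_div hA hdm hdi hd0] at hlog hint'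
  exact ⟨hint', hlog⟩

theorem ActivityPair.insertionCost_contract {A : X → X → Prop}
    (hA : MeasurableSet {p : X × X | A p.1 p.2}) (hs : ∀ x y, A x y → A y x) {Φ : X → ℝ}
    (hΦm : Measurable Φ) (hΦ : Integrable Φ m) {κ δ D : ℝ}
    (hκ : ∀ y, ∫ x, (Φ x - cutOff A y Φ x) ∂m ≤ κ) (hδ : 0 ≤ δ)
    (hD : ∀ φ ψ, ActivityPair Φ δ φ ψ →
      ∀ y, |insertionCost m A φ y - insertionCost m A ψ y| ≤ D)
    {φ ψ : X → ℝ} (h : ActivityPair Φ δ φ ψ) (y : X) :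
    |insertionCost m A φ y - insertionCost m A ψ y| ≤ κ * (δ + D) := by
  have hD0 : 0 ≤ D := (abs_nonneg _).trans (hD φ ψ h y)
  have hdim (u : ℝ) (hu0 : 0 ≤ u) (hu1 : u ≤ 1) :
      ActivityPair Φ δ (dimmed A y u φ) (dimmed A y u ψ) := by
    refine h.mul (k := fun x => if A y x then 1 else u) ?_ (fun x => ?_) fun x => ?_
    · refine Measurable.ite ?_ measurable_const measurable_const
      exact (measurable_const.prodMk measurable_id) hA
    · split_ifs <;> simp [hu0]
    · split_ifs <;> simp [hu1]
  have hder (u : ℝ) (hu : u ∈ Set.Icc (0 : ℝ) 1) :=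
    hasDerivAt_log_gibbsZ_dimmed (m := m) hA hs h.meas_left (h.integrable_left hΦ) h.nonneg_left y
      hu.1 (hdim u hu.1 hu.2).meas_left ((hdim u hu.1 hu.2).integrable_left hΦ)
  have hder' (u : ℝ) (hu : u ∈ Set.Icc (0 : ℝ) 1) :=
    hasDerivAt_log_gibbsZ_dimmed (m := m) hA hs h.meas_right (h.integrable_right hΦ)
      h.nonneg_right y hu.1 (hdim u hu.1 hu.2).meas_right
      ((hdim u hu.1 hu.2).integrable_right hΦ)
  have hmv := norm_image_sub_le_of_norm_deriv_le_segment_01' (C := κ * (δ + D))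
    (fun u hu => ((hder u hu).2.sub (hder' u hu).2).hasDerivWithinAt) fun u hu => by
      have hu' : u ∈ Set.Icc (0 : ℝ) 1 := ⟨hu.1, hu.2.le⟩
      rw [← integral_sub (hder u hu').1 (hder' u hu').1]
      refine (norm_integral_le_of_norm_le (g := fun x => (Φ x - cutOff A y Φ x) * (δ + D))
        ((hΦ.sub (integrable_cutOff hA hΦm hΦ y)).mul_const _) (ae_of_all _ fun x => ?_)).trans ?_
      · by_cases hx : A y x
        · simp [cutOff, hx]
        · simp only [cutOff, hx, if_false, sub_zero]
          exact (hdim u hu'.1 hu'.2).abs_density_sub_le hA hΦ hδ (hD _ _ (hdim u hu'.1 hu'.2) x)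
            (h.nonneg_left x) (h.nonneg_right x) (h.le_left x) (h.le_right x) (h.left_le x)
            (h.right_le x)
      · rw [integral_mul_const]
        exact mul_le_mul_of_nonneg_right (hκ y) (by positivity)
  have hone (f : X → ℝ) : dimmed A y 1 f = f := by
    funext x; simp [dimmed]
  have hzero (f : X → ℝ) : dimmed A y 0 f = cutOff A y f := by
    funext x; simp [dimmed, cutOff]
  simp only [Pi.sub_apply, hone, hzero, Real.norm_eq_abs] at hmv
  convert hmv using 2
  unfold insertionCost
  ring

/-- At low density the insertion cost depends Lipschitz continuously on the log-activity. -/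
theorem ActivityPair.abs_insertionCost_sub_le {A : X → X → Prop}
    (hA : MeasurableSet {p : X × X | A p.1 p.2}) (hs : ∀ x y, A x y → A y x) {Φ : X → ℝ}
    (hΦm : Measurable Φ) (hΦ : Integrable Φ m) {δ : ℝ}
    (hκ : ∀ y, ∫ x, (Φ x - cutOff A y Φ x) ∂m ≤ 1 / 2) (hδ : 0 ≤ δ)
    {φ ψ : X → ℝ} (h : ActivityPair Φ δ φ ψ) (y : X) :
    |insertionCost m A φ y - insertionCost m A ψ y| ≤ δ := by
  set D₀ := Real.log (gibbsZ m A Φ)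
  have key (k : ℕ) : ∀ φ ψ, ActivityPair Φ δ φ ψ →
      ∀ y, |insertionCost m A φ y - insertionCost m A ψ y| ≤ δ + D₀ * (1 / 2) ^ k := by
    induction k with
    | zero =>
      intro φ ψ h y
      have h1 := insertionCost_nonneg hA h.meas_left (h.integrable_left hΦ) h.nonneg_left y
      have h2 := insertionCost_nonneg hA h.meas_right (h.integrable_right hΦ) h.nonneg_right y
      have h3 := insertionCost_le hA h.meas_left (h.integrable_left hΦ) h.nonneg_left hΦm hΦ
        h.le_left y
      have h4 := insertionCost_le hA h.meas_right (h.integrable_right hΦ) h.nonneg_right hΦm hΦ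
        h.le_right y
      rw [abs_le, pow_zero, mul_one]
      constructor <;> linarith
    | succ k ih =>
      intro φ ψ h y
      refine (h.insertionCost_contract hA hs hΦm hΦ hκ hδ ih y).trans (le_of_eq ?_)
      rw [pow_succ]
      ring
  have hlim : Filter.Tendsto (fun k : ℕ => δ + D₀ * (1 / 2) ^ k) Filter.atTop (nhds δ) := by
    have := tendsto_pow_atTop_nhds_zero_of_lt_one (r := (1 / 2 : ℝ)) (by norm_num) (by norm_num)
    simpa using (this.const_mul D₀).const_add δ
  exact ge_of_tendsto' hlim fun k => key k φ ψ h y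

/-- The linear statistic of `g`. -/
def linearStat (g : X → ℝ) (ω : Conf X) : ℝ := ∑ i, g (ω.2 i)

/-- The mean of the linear statistic of `g` in the Gibbs measure of activity `φ`. -/
def gibbsMean (m : Measure X) (A : X → X → Prop) (φ g : X → ℝ) : ℝ :=
  (gibbsZ m A φ)⁻¹ * ∫ ω, compatInd A ω * prodWeight φ ω * linearStat g ω ∂poissonMeasure m

omit [MeasurableSpace X] in
theorem prodWeight_mul_linearStat (φ g : X → ℝ) (ω : Conf X) :
    prodWeight φ ω * linearStat g ω = markedWeight (fun x => g x * φ x) φ ω := by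
  unfold prodWeight linearStat markedWeight
  rw [Finset.mul_sum]
  refine Finset.sum_congr rfl fun i _ => ?_
  rw [mul_assoc, Finset.mul_prod_erase Finset.univ (fun j => φ (ω.2 j)) (Finset.mem_univ i),
    mul_comm]

omit [MeasurableSpace X] in
theorem prodWeight_mul_exp (φ g : X → ℝ) (t : ℝ) (ω : Conf X) :
    prodWeight (fun x => φ x * Real.exp (t * g x)) ω =
      prodWeight φ ω * Real.exp (t * linearStat g ω) := by
  unfold prodWeight linearStat
  rw [Finset.prod_mul_distrib, ← Real.exp_sum, Finset.mul_sum]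

omit [SigmaFinite m] in
theorem integrable_mul_of_bounded {g φ : X → ℝ} {B : ℝ} (hg : Measurable g) (hB : ∀ x, |g x| ≤ B)
    (hφ : Integrable φ m) : Integrable (fun x => g x * φ x) m :=
  hφ.bdd_mul hg.aestronglyMeasurable (ae_of_all _ hB)

theorem integrable_linearStat {A : X → X → Prop}
    (hA : MeasurableSet {p : X × X | A p.1 p.2}) {φ g : X → ℝ} {B : ℝ} (hφm : Measurable φ)
    (hφ : Integrable φ m) (hg : Measurable g) (hB : ∀ x, |g x| ≤ B) :
    Integrable (fun ω => compatInd A ω * prodWeight φ ω * linearStat g ω) (poissonMeasure m) := by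
  simp only [mul_assoc, prodWeight_mul_linearStat]
  exact integrable_marked hA (hg.mul hφm) hφm (integrable_mul_of_bounded hg hB hφ) hφ

theorem gibbsMean_eq {A : X → X → Prop}
    (hA : MeasurableSet {p : X × X | A p.1 p.2}) (hs : ∀ x y, A x y → A y x) {φ g : X → ℝ} {B : ℝ}
    (hφm : Measurable φ) (hφ : Integrable φ m) (h0 : ∀ x, 0 ≤ φ x) (hg : Measurable g)
    (hB : ∀ x, |g x| ≤ B) :
    Integrable (fun x => g x * (φ x * Real.exp (-insertionCost m A φ x))) m ∧
    gibbsMean m A φ g = ∫ x, g x * (φ x * Real.exp (-insertionCost m A φ x)) ∂m := by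
  have hgi := integrable_mul_of_bounded hg hB hφ
  have hgm : Measurable fun x => g x * φ x := hg.mul hφm
  have hint := (integrable_mul_gibbsZ_cutOff (m := m) hA hgm hφm hgi hφ).div_const
    (gibbsZ m A φ)
  simp only [mul_div_assoc, gibbsZ_cutOff_div hA hφm hφ h0, mul_assoc] at hint
  refine ⟨hint, ?_⟩
  unfold gibbsMean
  simp only [mul_assoc, prodWeight_mul_linearStat]
  rw [integral_marked hA hs hgm hφm hgi hφ, inv_mul_eq_div, ← integral_div]
  simp only [mul_div_assoc, gibbsZ_cutOff_div hA hφm hφ h0, mul_assoc]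

theorem ActivityPair.abs_gibbsMean_sub_le {A : X → X → Prop}
    (hA : MeasurableSet {p : X × X | A p.1 p.2}) (hs : ∀ x y, A x y → A y x) {Φ : X → ℝ}
    (hΦm : Measurable Φ) (hΦ : Integrable Φ m) {δ : ℝ}
    (hκ : ∀ y, ∫ x, (Φ x - cutOff A y Φ x) ∂m ≤ 1 / 2) (hδ : 0 ≤ δ)
    {φ ψ : X → ℝ} (h : ActivityPair Φ δ φ ψ) {g : X → ℝ} {B : ℝ} (hg : Measurable g)
    (hB0 : 0 ≤ B) (hB : ∀ x, |g x| ≤ B) :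
    |gibbsMean m A φ g - gibbsMean m A ψ g| ≤ B * (2 * δ) * ∫ x, Φ x ∂m := by
  obtain ⟨hi1, he1⟩ := gibbsMean_eq hA hs h.meas_left (h.integrable_left hΦ) h.nonneg_left hg hB
  obtain ⟨hi2, he2⟩ := gibbsMean_eq hA hs h.meas_right (h.integrable_right hΦ) h.nonneg_right hg hB
  rw [he1, he2, ← integral_sub hi1 hi2, ← integral_const_mul, ← Real.norm_eq_abs]
  refine norm_integral_le_of_norm_le (hΦ.const_mul _) (ae_of_all _ fun x => ?_)
  rw [← mul_sub, Real.norm_eq_abs, abs_mul]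
  have := h.abs_density_sub_le hA hΦ hδ (h.abs_insertionCost_sub_le hA hs hΦm hΦ hκ hδ x)
    (h.nonneg_left x) (h.nonneg_right x) (h.le_left x) (h.le_right x) (h.left_le x) (h.right_le x)
  calc _ ≤ B * (Φ x * (δ + δ)) := mul_le_mul (hB x) this (abs_nonneg _) hB0
    _ = _ := by ring

theorem activityPair_exp {φ g Φ : X → ℝ} {B t : ℝ} (hφm : Measurable φ) (h0 : ∀ x, 0 ≤ φ x)
    (hg : Measurable g) (hB : ∀ x, |g x| ≤ B) (hΦ : ∀ x, Real.exp (|t| * B) * φ x ≤ Φ x) :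
    ActivityPair Φ (|t| * B) (fun x => φ x * Real.exp (t * g x)) φ := by
  have habs (x : X) : |t * g x| ≤ |t| * B := by
    rw [abs_mul]
    exact mul_le_mul_of_nonneg_left (hB x) (abs_nonneg t)
  have hle (x : X) : φ x * Real.exp (t * g x) ≤ Real.exp (|t| * B) * φ x := by
    rw [mul_comm]
    exact mul_le_mul_of_nonneg_right
      (Real.exp_le_exp.2 ((le_abs_self _).trans (habs x))) (h0 x)
  refine ⟨hφm.mul (hg.const_mul t).exp, hφm, fun x => mul_nonneg (h0 x) (Real.exp_pos _).le, h0,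
    fun x => (hle x).trans (hΦ x), fun x => le_trans ?_ (hΦ x), hle, fun x => ?_⟩
  · exact le_mul_of_one_le_left (h0 x)
      (Real.one_le_exp ((abs_nonneg _).trans (habs x)))
  · rw [mul_left_comm, ← Real.exp_add]
    refine le_mul_of_one_le_right (h0 x) (Real.one_le_exp ?_)
    have := neg_abs_le (t * g x)
    linarith [habs x]

theorem gibbsZ_exp_le {A : X → X → Prop} (hA : MeasurableSet {p : X × X | A p.1 p.2})
    {φ g : X → ℝ} {B t : ℝ} (hφm : Measurable φ) (hφ : Integrable φ m)
    (hψm : Measurable fun x => φ x * Real.exp (t * g x))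
    (hψ : Integrable (fun x => φ x * Real.exp (t * g x)) m) (h0 : ∀ x, 0 ≤ φ x)
    (hg : Measurable g) (hB : ∀ x, |g x| ≤ B) :
    gibbsZ m A (fun x => φ x * Real.exp (t * g x)) ≤
      gibbsZ m A φ * Real.exp (t * gibbsMean m A (fun x => φ x * Real.exp (t * g x)) g) := by
  set ψ := fun x => φ x * Real.exp (t * g x) with hψdef
  have hψ0 : ∀ x, 0 ≤ ψ x := fun x => mul_nonneg (h0 x) (Real.exp_pos _).le
  have h1 := one_le_gibbsZ (m := m) hA hψm hψ hψ0
  set M := gibbsMean m A ψ g with hM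
  have hiS := integrable_linearStat (m := m) hA hψm hψ hg hB
  have hi := integrable_gibbs (m := m) hA hψm hψ
  have hval : ∫ ω, compatInd A ω * prodWeight ψ ω * linearStat g ω ∂poissonMeasure m =
      gibbsZ m A ψ * M := by
    rw [hM, gibbsMean, mul_inv_cancel_left₀ (by linarith)]
  have hmono : ∫ ω, Real.exp (-(t * M)) * ((1 + t * M) * (compatInd A ω * prodWeight ψ ω) -
      t * (compatInd A ω * prodWeight ψ ω * linearStat g ω)) ∂poissonMeasure m ≤ gibbsZ m A φ := by
    refine integral_mono (((hi.const_mul _).sub (hiS.const_mul _)).const_mul _)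
      (integrable_gibbs hA hφm hφ) fun ω => ?_
    have hW : prodWeight φ ω = prodWeight ψ ω * Real.exp (-(t * linearStat g ω)) := by
      rw [hψdef, prodWeight_mul_exp, mul_assoc, ← Real.exp_add, add_neg_cancel, Real.exp_zero,
        mul_one]
    have hW0 : 0 ≤ compatInd A ω * prodWeight ψ ω :=
      mul_nonneg (compatInd_nonneg ω) (Finset.prod_nonneg fun i _ => hψ0 _)
    have hexp := Real.add_one_le_exp (t * M - t * linearStat g ω)
    have he : Real.exp (-(t * linearStat g ω)) =
        Real.exp (-(t * M)) * Real.exp (t * M - t * linearStat g ω) := by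
      rw [← Real.exp_add]; congr 1; ring
    simp only [hW, he]
    have := mul_le_mul_of_nonneg_left hexp
      (mul_nonneg (Real.exp_pos (-(t * M))).le hW0)
    linarith
  rw [integral_const_mul, integral_sub (hi.const_mul _) (hiS.const_mul _), integral_const_mul,
    integral_const_mul, hval, ← gibbsZ] at hmono
  have h2 : Real.exp (-(t * M)) * gibbsZ m A ψ ≤ gibbsZ m A φ := by
    convert hmono using 1
    ring
  rwa [Real.exp_neg, inv_mul_le_iff₀ (Real.exp_pos _), mul_comm] at h2

theorem integrable_exp_linearStat {A : X → X → Prop}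
    (hA : MeasurableSet {p : X × X | A p.1 p.2}) {φ g : X → ℝ} {t c : ℝ}
    (hψm : Measurable fun x => φ x * Real.exp (t * g x))
    (hψ : Integrable (fun x => φ x * Real.exp (t * g x)) m) :
    Integrable (fun ω => compatInd A ω * prodWeight φ ω * Real.exp (t * (linearStat g ω - c)))
      (poissonMeasure m) := by
  convert (integrable_gibbs (m := m) hA hψm hψ).mul_const (Real.exp (-(t * c))) using 2 with ω
  rw [prodWeight_mul_exp, mul_sub, sub_eq_add_neg, Real.exp_add]
  ring

/-- Gaussian exponential moments of centred linear statistics at low density. -/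
theorem integral_exp_centred_le {A : X → X → Prop}
    (hA : MeasurableSet {p : X × X | A p.1 p.2}) (hs : ∀ x y, A x y → A y x) {φ g Φ : X → ℝ}
    {B t : ℝ} (hφm : Measurable φ) (h0 : ∀ x, 0 ≤ φ x) (hg : Measurable g) (hB0 : 0 ≤ B)
    (hB : ∀ x, |g x| ≤ B) (hΦm : Measurable Φ) (hΦi : Integrable Φ m)
    (hκ : ∀ y, ∫ x, (Φ x - cutOff A y Φ x) ∂m ≤ 1 / 2)
    (hΦ : ∀ x, Real.exp (|t| * B) * φ x ≤ Φ x) :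
    Integrable (fun ω => compatInd A ω * prodWeight φ ω *
      Real.exp (t * (linearStat g ω - gibbsMean m A φ g))) (poissonMeasure m) ∧
    ∫ ω, compatInd A ω * prodWeight φ ω *
        Real.exp (t * (linearStat g ω - gibbsMean m A φ g)) ∂poissonMeasure m ≤
      gibbsZ m A φ * Real.exp (2 * B ^ 2 * t ^ 2 * ∫ x, Φ x ∂m) := by
  have h := activityPair_exp hφm h0 hg hB hΦ
  have hψi := h.integrable_left hΦi
  have hφi := h.integrable_right hΦi
  refine ⟨integrable_exp_linearStat hA h.meas_left hψi, ?_⟩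
  set ψ := fun x => φ x * Real.exp (t * g x) with hψdef
  have hmean := h.abs_gibbsMean_sub_le hA hs hΦm hΦi hκ (by positivity) hg hB0 hB
  have hZ := gibbsZ_exp_le hA hφm hφi h.meas_left hψi h0 hg hB
  rw [← hψdef] at hZ
  have h1 := one_le_gibbsZ (m := m) hA hφm hφi h0
  have heq : ∫ ω, compatInd A ω * prodWeight φ ω *
        Real.exp (t * (linearStat g ω - gibbsMean m A φ g)) ∂poissonMeasure m =
      gibbsZ m A ψ * Real.exp (-(t * gibbsMean m A φ g)) := by
    rw [gibbsZ, ← integral_mul_const]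
    congr 1
    funext ω
    rw [hψdef, prodWeight_mul_exp, mul_sub, sub_eq_add_neg, Real.exp_add]
    ring
  rw [heq]
  calc _ ≤ gibbsZ m A φ * Real.exp (t * gibbsMean m A ψ g) *
          Real.exp (-(t * gibbsMean m A φ g)) :=
        mul_le_mul_of_nonneg_right hZ (Real.exp_pos _).le
    _ = gibbsZ m A φ * Real.exp (t * (gibbsMean m A ψ g - gibbsMean m A φ g)) := by
        rw [mul_assoc, ← Real.exp_add]
        ring_nf
    _ ≤ _ := by
        refine mul_le_mul_of_nonneg_left (Real.exp_le_exp.2 ?_) (by linarith)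
        calc _ ≤ |t| * |gibbsMean m A ψ g - gibbsMean m A φ g| := by
              rw [← abs_mul]; exact le_abs_self _
          _ ≤ |t| * (B * (2 * (|t| * B)) * ∫ x, Φ x ∂m) :=
              mul_le_mul_of_nonneg_left hmean (abs_nonneg _)
          _ = _ := by rw [← sq_abs t]; ring

end Configurations

theorem abs_pow_le_factorial_mul_exp (x : ℝ) (p : ℕ) :
    |x ^ p| ≤ p.factorial * (Real.exp x + Real.exp (-x)) := by
  have h := Real.pow_div_factorial_le_exp |x| (abs_nonneg x) p
  rw [div_le_iff₀ (by positivity), ← abs_pow, mul_comm] at h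
  refine h.trans (mul_le_mul_of_nonneg_left ?_ (by positivity))
  rcases abs_cases x with ⟨h, -⟩ | ⟨h, -⟩ <;> rw [h] <;>
    linarith [Real.exp_pos x, Real.exp_pos (-x)]

theorem integral_mul_pow_le {Ω : Type*} [MeasurableSpace Ω] {P : Measure Ω} {W Y : Ω → ℝ} {K : ℝ}
    (hW : Measurable W) (hW0 : ∀ ω, 0 ≤ W ω) (hY : Measurable Y) (p : ℕ)
    (h₁ : Integrable (fun ω => W ω * Real.exp (Y ω)) P)
    (h₂ : Integrable (fun ω => W ω * Real.exp (-Y ω)) P)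
    (hK₁ : ∫ ω, W ω * Real.exp (Y ω) ∂P ≤ K) (hK₂ : ∫ ω, W ω * Real.exp (-Y ω) ∂P ≤ K) :
    Integrable (fun ω => W ω * Y ω ^ p) P ∧
      |∫ ω, W ω * Y ω ^ p ∂P| ≤ p.factorial * (2 * K) := by
  have hi := (h₁.add h₂).const_mul (p.factorial : ℝ)
  have hle (ω : Ω) : ‖W ω * Y ω ^ p‖ ≤
      p.factorial * (W ω * Real.exp (Y ω) + W ω * Real.exp (-Y ω)) := by
    rw [Real.norm_eq_abs, abs_mul, abs_of_nonneg (hW0 ω)]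
    calc _ ≤ W ω * (p.factorial * (Real.exp (Y ω) + Real.exp (-Y ω))) :=
          mul_le_mul_of_nonneg_left (abs_pow_le_factorial_mul_exp _ _) (hW0 ω)
      _ = _ := by ring
  refine ⟨hi.mono' (hW.mul (hY.pow_const p)).aestronglyMeasurable (ae_of_all _ hle), ?_⟩
  rw [← Real.norm_eq_abs]
  refine (norm_integral_le_of_norm_le hi (ae_of_all _ hle)).trans ?_
  rw [integral_const_mul]
  refine mul_le_mul_of_nonneg_left ?_ (by positivity)
  calc _ = (∫ ω, W ω * Real.exp (Y ω) ∂P) + ∫ ω, W ω * Real.exp (-Y ω) ∂P := integral_add h₁ h₂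
    _ ≤ _ := by linarith

section HardSpheres

variable {d : ℕ} {ε : ℝ}

theorem torusDist_comm (x y : Torus d) : torusDist x y = torusDist y x := by
  simp only [torusDist, dist_comm]

theorem dist_le_torusDist (x y : Torus d) (i : Fin d) : dist (x i) (y i) ≤ torusDist x y :=
  Real.le_sqrt_of_sq_le <| Finset.single_le_sum (f := fun i => dist (x i) (y i) ^ 2)
    (fun _ _ => sq_nonneg _) (Finset.mem_univ i)

/-- The hard-sphere compatibility relation between two particles. -/
def Apart (d : ℕ) (ε : ℝ) (z w : Phase d) : Prop := ε < torusDist z.1 w.1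

theorem Apart.symm (z w : Phase d) (h : Apart d ε z w) : Apart d ε w z := by
  unfold Apart at *
  rwa [torusDist_comm]

theorem measurableSet_apart : MeasurableSet {p : Phase d × Phase d | Apart d ε p.1 p.2} := by
  have h : Continuous fun p : Phase d × Phase d => torusDist p.1.1 p.2.1 := by
    unfold torusDist
    fun_prop
  exact measurableSet_lt measurable_const h.measurable

theorem maxwellian_nonneg (v : EuclideanSpace ℝ (Fin d)) : 0 ≤ maxwellian d v := by
  unfold maxwellian
  positivity

theorem measurable_maxwellian : Measurable (maxwellian d) := by
  unfold maxwellian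
  fun_prop

theorem integral_maxwellian : ∫ v, maxwellian d v = 1 := by
  unfold maxwellian
  rw [integral_const_mul]
  have h := GaussianFourier.integral_rexp_neg_mul_sq_norm (V := EuclideanSpace ℝ (Fin d))
    (b := 1 / 2) (by norm_num)
  rw [finrank_euclideanSpace_fin] at h
  have he (v : EuclideanSpace ℝ (Fin d)) : -‖v‖ ^ 2 / 2 = -(1 / 2) * ‖v‖ ^ 2 := by ring
  simp only [he]
  rw [h, div_div_eq_mul_div, div_one, mul_comm π 2, neg_div, ← Real.rpow_add (by positivity)]
  simp

theorem integrable_maxwellian : Integrable (maxwellian d) :=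
  integrable_of_integral_eq_one integral_maxwellian

/-- The activity `μ_ε M(v)` times a constant. -/
def activity (d : ℕ) (ε c : ℝ) (z : Phase d) : ℝ := c * mu d ε * maxwellian d z.2

theorem mu_pos (hε : 0 < ε) : 0 < mu d ε := zpow_pos hε _

theorem one_le_mu (hd : 1 ≤ d) (hε : 0 < ε) (hε1 : ε ≤ 1) : 1 ≤ mu d ε := by
  have : mu d ε = (ε ^ (d - 1))⁻¹ := by
    rw [mu, zpow_neg, ← zpow_natCast, Nat.cast_sub hd, Nat.cast_one]
  rw [this]
  exact (one_le_inv₀ (by positivity)).2 (pow_le_one₀ hε.le hε1)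

theorem mu_mul_pow (hε : 0 < ε) : mu d ε * ε ^ d = ε := by
  rw [mu, ← zpow_natCast, ← zpow_add₀ hε.ne']
  simp

theorem measurable_activity (c : ℝ) : Measurable (activity d ε c) :=
  (measurable_maxwellian.comp measurable_snd).const_mul _

theorem activity_nonneg (hε : 0 < ε) {c : ℝ} (hc : 0 ≤ c) (z : Phase d) :
    0 ≤ activity d ε c z :=
  mul_nonneg (mul_nonneg hc (mu_pos hε).le) (maxwellian_nonneg _)

theorem integrable_activity (c : ℝ) : Integrable (activity d ε c) :=
  (integrable_maxwellian.comp_snd _).const_mul _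

theorem integral_activity (c : ℝ) : ∫ z, activity d ε c z = c * mu d ε := by
  unfold activity
  rw [integral_const_mul]
  have := integral_prod_mul (μ := (volume : Measure (Torus d)))
    (ν := (volume : Measure (EuclideanSpace ℝ (Fin d)))) (fun _ => (1 : ℝ)) (maxwellian d)
  rw [integral_maxwellian] at this
  simp only [one_mul] at this
  rw [Measure.volume_eq_prod, this]
  simp [measureReal_def, volume_pi, Measure.pi_univ, AddCircle.measure_univ]

theorem measureReal_torusDist_le (hε : 0 < ε) (x : Torus d) :
    (volume : Measure (Torus d)).real {y | ¬ ε < torusDist x y} ≤ (2 * ε) ^ d := by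
  have hsub : {y : Torus d | ¬ ε < torusDist x y} ⊆
      Set.univ.pi fun i => Metric.closedBall (x i) ε := by
    intro y hy i _
    rw [Metric.mem_closedBall, dist_comm]
    exact (dist_le_torusDist x y i).trans (not_lt.1 hy)
  have hball (i : Fin d) : volume (Metric.closedBall (x i) ε) ≤ ENNReal.ofReal (2 * ε) := by
    rw [AddCircle.volume_closedBall]
    exact ENNReal.ofReal_le_ofReal (min_le_right _ _)
  refine ENNReal.toReal_le_of_le_ofReal (by positivity) ((measure_mono hsub).trans ?_)
  rw [volume_pi, Measure.pi_pi, ENNReal.ofReal_pow (by positivity)]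
  refine (Finset.prod_le_prod' fun i _ => hball i).trans ?_
  simp

theorem integral_activity_sub_cutOff_le (hε : 0 < ε) {c : ℝ} (hc : 0 ≤ c) (y : Phase d) :
    ∫ z, (activity d ε c z - cutOff (Apart d ε) y (activity d ε c) z) ≤ c * 2 ^ d * ε := by
  set S : Set (Torus d) := {x | ¬ ε < torusDist y.1 x} with hS
  have hSm : MeasurableSet S := by
    have h : Continuous fun x : Torus d => torusDist y.1 x := by
      unfold torusDist
      fun_prop
    exact (measurableSet_lt measurable_const h.measurable).compl
  have heq (z : Phase d) : activity d ε c z - cutOff (Apart d ε) y (activity d ε c) z =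
      c * mu d ε * (S.indicator (fun _ => (1 : ℝ)) z.1 * maxwellian d z.2) := by
    by_cases h : ε < torusDist y.1 z.1 <;> simp [cutOff, Apart, activity, Set.indicator, hS, h]
  simp only [heq]
  rw [integral_const_mul, Measure.volume_eq_prod, integral_prod_mul, integral_maxwellian, mul_one,
    integral_indicator_const _ hSm, smul_eq_mul, mul_one]
  calc _ ≤ c * mu d ε * (2 * ε) ^ d :=
        mul_le_mul_of_nonneg_left (measureReal_torusDist_le hε y.1)
          (mul_nonneg hc (mu_pos hε).le)
    _ = c * 2 ^ d * (mu d ε * ε ^ d) := by rw [mul_pow]; ring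
    _ = _ := by rw [mu_mul_pow hε]

theorem compatInd_mul_prodWeight_activity {n : ℕ} (Z : Fin n → Phase d) :
    compatInd (Apart d ε) ⟨n, Z⟩ * prodWeight (activity d ε 1) ⟨n, Z⟩ =
      mu d ε ^ n * hsWeight d ε Z := by
  have : compatInd (Apart d ε) ⟨n, Z⟩ = if HardCore d ε Z then 1 else 0 := by
    unfold compatInd HardCore Apart
    congr
  simp only [this, hsWeight, prodWeight, activity, one_mul, Finset.prod_mul_distrib,
    Finset.prod_const, Finset.card_univ, Fintype.card_fin]
  ring

theorem hasSum_hsWeight {F : Conf (Phase d) → ℝ}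
    (hF : Integrable (fun ω => compatInd (Apart d ε) ω * prodWeight (activity d ε 1) ω * F ω)
      (poissonMeasure volume)) :
    HasSum (fun n : ℕ => mu d ε ^ n / n.factorial *
        ∫ Z : Fin n → Phase d, hsWeight d ε Z * F ⟨n, Z⟩)
      (∫ ω, compatInd (Apart d ε) ω * prodWeight (activity d ε 1) ω * F ω
        ∂poissonMeasure volume) := by
  convert hasSum_poisson hF using 2 with n
  simp only [compatInd_mul_prodWeight_activity, mul_assoc]
  rw [integral_const_mul, ← volume_pi]
  ring

theorem partitionFn_eq : partitionFn d ε = gibbsZ volume (Apart d ε) (activity d ε 1) := by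
  have h := hasSum_hsWeight (d := d) (ε := ε) (F := fun _ => 1) (by
    simpa only [mul_one] using
      integrable_gibbs measurableSet_apart (measurable_activity 1) (integrable_activity 1))
  simp only [mul_one] at h
  exact h.tsum_eq

theorem Eexp_eq {F : Conf (Phase d) → ℝ}
    (hF : Integrable (fun ω => compatInd (Apart d ε) ω * prodWeight (activity d ε 1) ω * F ω)
      (poissonMeasure volume)) :
    Eexp d ε (fun n Z => F ⟨n, Z⟩) = (gibbsZ volume (Apart d ε) (activity d ε 1))⁻¹ *
      ∫ ω, compatInd (Apart d ε) ω * prodWeight (activity d ε 1) ω * F ω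
        ∂poissonMeasure volume := by
  rw [Eexp, partitionFn_eq, (hasSum_hsWeight hF).tsum_eq]

theorem integrable_empAvg {g : Phase d → ℝ} {B : ℝ} (hg : Measurable g) (hB : ∀ z, |g z| ≤ B) :
    Integrable (fun ω => compatInd (Apart d ε) ω * prodWeight (activity d ε 1) ω *
      empAvg d ε g ω.2) (poissonMeasure volume) := by
  convert (integrable_linearStat (m := volume) (A := Apart d ε) measurableSet_apart
    (measurable_activity 1) (integrable_activity 1) hg hB).const_mul (mu d ε)⁻¹ using 2 with ω
  simp only [empAvg, linearStat]
  ring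

theorem fluct_eq {g : Phase d → ℝ} {B : ℝ} (hg : Measurable g)
    (hB : ∀ z, |g z| ≤ B) (ω : Conf (Phase d)) :
    fluct d ε g ω.1 ω.2 = (√(mu d ε))⁻¹ *
      (linearStat g ω - gibbsMean volume (Apart d ε) (activity d ε 1) g) := by
  have hmean : Eexp d ε (fun n Z => empAvg d ε g Z) =
      (mu d ε)⁻¹ * gibbsMean volume (Apart d ε) (activity d ε 1) g := by
    rw [Eexp_eq (F := fun ω => empAvg d ε g ω.2) (integrable_empAvg hg hB), gibbsMean,
      mul_left_comm]
    congr 1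
    rw [← integral_const_mul]
    refine integral_congr_ae (ae_of_all _ fun ω => ?_)
    simp only [empAvg, linearStat]
    ring
  have hsq : √(mu d ε) * (mu d ε)⁻¹ = (√(mu d ε))⁻¹ := by
    rw [← div_eq_mul_inv, Real.sqrt_div_self', one_div]
  rw [fluct, hmean, ← hsq]
  simp only [empAvg, linearStat]
  ring

theorem measurable_linearStat {X : Type*} [MeasurableSpace X] {g : X → ℝ} (hg : Measurable g) :
    Measurable (linearStat g) :=
  measurable_conf fun n => by
    unfold linearStat
    exact Finset.measurable_sum Finset.univ (f := fun i (Z : Fin n → X) => g (Z i)) fun i _ =>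
      hg.comp (measurable_pi_apply i)

theorem integral_exp_fluct_le (hd : 1 ≤ d) (hε : 0 < ε) (hε1 : ε ≤ 1) {g : Phase d → ℝ} {B : ℝ}
    (hB0 : 0 ≤ B) (hεB : Real.exp B * 2 ^ d * ε ≤ 1 / 2) (hg : Measurable g)
    (hB : ∀ z, |g z| ≤ B) {s : ℝ} (hs : |s| = 1) :
    Integrable (fun ω => compatInd (Apart d ε) ω * prodWeight (activity d ε 1) ω *
      Real.exp (s * fluct d ε g ω.1 ω.2)) (poissonMeasure volume) ∧
    ∫ ω, compatInd (Apart d ε) ω * prodWeight (activity d ε 1) ω *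
        Real.exp (s * fluct d ε g ω.1 ω.2) ∂poissonMeasure volume ≤
      gibbsZ volume (Apart d ε) (activity d ε 1) * Real.exp (2 * B ^ 2 * Real.exp B) := by
  have hmu := one_le_mu hd hε hε1
  have hsq : 1 ≤ √(mu d ε) := Real.one_le_sqrt.2 hmu
  set t := s * (√(mu d ε))⁻¹ with ht
  have habs : |t| ≤ 1 := by
    rw [ht, abs_mul, hs, one_mul, abs_of_nonneg (by positivity)]
    exact inv_le_one_of_one_le₀ hsq
  have h := integral_exp_centred_le (m := volume) (A := Apart d ε) (t := t) measurableSet_apart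
    Apart.symm (measurable_activity 1) (activity_nonneg hε zero_le_one) hg hB0 hB
    (measurable_activity (Real.exp B)) (integrable_activity _)
    (fun y => (integral_activity_sub_cutOff_le hε (Real.exp_pos B).le y).trans hεB) fun z => by
      have h1 : Real.exp (|t| * B) ≤ Real.exp B :=
        Real.exp_le_exp.2 (mul_le_of_le_one_left hB0 habs)
      have h2 := mul_le_mul_of_nonneg_right h1 (activity_nonneg hε zero_le_one z)
      refine h2.trans (le_of_eq ?_)
      unfold activity
      ring
  have hexp : 2 * B ^ 2 * t ^ 2 * (Real.exp B * mu d ε) = 2 * B ^ 2 * Real.exp B := by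
    have ht2 : t ^ 2 * mu d ε = 1 := by
      rw [ht, mul_pow, ← sq_abs s, hs, inv_pow, Real.sq_sqrt (by linarith), one_pow, one_mul,
        inv_mul_cancel₀ (by linarith)]
    linear_combination 2 * B ^ 2 * Real.exp B * ht2
  simp only [fluct_eq hg hB, ← mul_assoc, ← ht] at h ⊢
  rwa [integral_activity, hexp] at h

end HardSpheres

/-- Proposition A.1: boundedness of all moments of the equilibrium fluctuation field.
For bounded measurable `g₀` (with `|g₀| ≤ B`) and every `p ≥ 1` there are `C_p > 0`
and `ε₀ ∈ (0,1)`, depending only on `d`, `p` and `B`, such that for `0 < ε < ε₀` the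
expectation `E_ε(ζ(g₀)^p)` converges absolutely and `|E_ε(ζ(g₀)^p)| ≤ C_p`. -/
theorem stmt_11 (d : ℕ) (hd : 2 ≤ d) (p : ℕ) (hp : 1 ≤ p) (B : ℝ) (hB : 0 ≤ B) :
    ∃ C : ℝ, 0 < C ∧ ∃ ε₀ ∈ Set.Ioo (0 : ℝ) 1,
      ∀ ε : ℝ, 0 < ε → ε < ε₀ →
      ∀ g₀ : Phase d → ℝ, Measurable g₀ → (∀ z, |g₀ z| ≤ B) →
        Summable (fun n : ℕ =>
            |mu d ε ^ n / n.factorial *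
              ∫ Z : Fin n → Phase d, hsWeight d ε Z * empAvg d ε g₀ Z|) ∧
        Summable (fun n : ℕ =>
            |mu d ε ^ n / n.factorial *
              ∫ Z : Fin n → Phase d, hsWeight d ε Z * fluct d ε g₀ n Z ^ p|) ∧
        |Eexp d ε (fun n Z => fluct d ε g₀ n Z ^ p)| ≤ C := by
  refine ⟨p.factorial * (2 * Real.exp (2 * B ^ 2 * Real.exp B)), by positivity,
    (Real.exp B * 2 ^ (d + 1))⁻¹, ⟨by positivity, ?_⟩, fun ε hε hε₀ g hg hgB => ?_⟩
  · refine inv_lt_one_of_one_lt₀ (one_lt_mul_of_le_of_lt (Real.one_le_exp hB) ?_)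
    exact one_lt_pow₀ one_lt_two (Nat.succ_ne_zero d)
  have hεB : Real.exp B * 2 ^ d * ε ≤ 1 / 2 := by
    rw [lt_inv_comm₀ hε (by positivity), ← one_div, lt_div_iff₀ hε, pow_succ] at hε₀
    linarith
  have hε1 : ε ≤ 1 := by
    have h1 : 1 ≤ Real.exp B * 2 ^ d :=
      one_le_mul_of_one_le_of_one_le (Real.one_le_exp hB) (one_le_pow₀ one_le_two)
    nlinarith
  have hd1 : 1 ≤ d := by omega
  obtain ⟨hi₁, hK₁⟩ := integral_exp_fluct_le hd1 hε hε1 hB hεB hg hgB (s := 1) (by simp)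
  obtain ⟨hi₂, hK₂⟩ := integral_exp_fluct_le hd1 hε hε1 hB hεB hg hgB (s := -1) (by simp)
  simp only [one_mul, neg_one_mul] at hi₁ hK₁ hi₂ hK₂
  have hY : Measurable fun ω : Conf (Phase d) => fluct d ε g ω.1 ω.2 := by
    simp only [fluct_eq hg hgB]
    exact ((measurable_linearStat hg).sub_const _).const_mul _
  obtain ⟨hi, hle⟩ := integral_mul_pow_le
    ((measurable_compatInd measurableSet_apart).mul (measurable_prodWeight (measurable_activity 1)))
    (fun ω => mul_nonneg (compatInd_nonneg ω)
      (Finset.prod_nonneg fun i _ => activity_nonneg hε zero_le_one _)) hY p hi₁ hi₂ hK₁ hK₂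
  have hZ := one_le_gibbsZ (m := volume) (A := Apart d ε) measurableSet_apart
    (measurable_activity 1) (integrable_activity 1) (activity_nonneg hε zero_le_one)
  refine ⟨(hasSum_hsWeight (F := fun ω => empAvg d ε g ω.2)
    (integrable_empAvg hg hgB)).summable.abs,
    (hasSum_hsWeight (F := fun ω => fluct d ε g ω.1 ω.2 ^ p) hi).summable.abs, ?_⟩
  rw [Eexp_eq (F := fun ω => fluct d ε g ω.1 ω.2 ^ p) hi, abs_mul,
    abs_of_nonneg (by positivity), inv_mul_le_iff₀ (by linarith)]
  refine hle.trans (le_of_eq ?_)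
  ring
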